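/- arXiv:1001.1499 — 2 statements merged into one kernel-verified Lean document; each statement's English description precedes it below -/
import Mathlib

section
/- If 0 < ε < 1/8 and |η| ≤ 1/2, then the series ∑_{n=0}^∞ |α_n η_n'(η)| converges, every factor 1 + α_n η_n'(η) is strictly positive, and the infinite product ∏_{n=0}^∞ (1 + α_n η_n'(η)) converges to a strictly positive real number. -/
open Filter Topology

/-- `ε₀ = 0`, `εₙ = ε^(2^n)` for `n ≥ 1`. -/
noncomputable def epsSeq (ε : ℝ) (n : ℕ) : ℝ := if n = 0 then 0 else ε ^ (2 ^ n)

/-- `αₙ = 1 + εₙ`. -/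
noncomputable def alphaSeq (ε : ℝ) (n : ℕ) : ℝ := 1 + epsSeq ε n

/-- `η₀'(η) = η`, `η_{n+1}'(η) = αₙ² ηₙ'(η)² − ε_{n+1}/α_{n+1}`. -/
noncomputable def etaP (ε : ℝ) : ℕ → ℝ → ℝ
  | 0 => fun η => η
  | n + 1 => fun η =>
      alphaSeq ε n ^ 2 * (etaP ε n η) ^ 2 - epsSeq ε (n + 1) / alphaSeq ε (n + 1)

theorem epsSeq_nonneg {ε : ℝ} (hε : 0 ≤ ε) (n : ℕ) : 0 ≤ epsSeq ε n := by
  unfold epsSeq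
  split_ifs <;> positivity

theorem alphaSeq_pos {ε : ℝ} (hε : 0 ≤ ε) (n : ℕ) : 0 < alphaSeq ε n := by
  have := epsSeq_nonneg hε n
  unfold alphaSeq
  positivity

theorem epsSeq_succ_le {ε : ℝ} (hε : 0 ≤ ε) (hε8 : ε ≤ 1 / 8) (n : ℕ) :
    epsSeq ε (n + 1) ≤ 1 / 64 * (2 / 3) ^ n := by
  have hn : n + 2 ≤ 2 ^ (n + 1) := Nat.lt_two_pow_self (n := n + 1)
  calc epsSeq ε (n + 1) = ε ^ 2 ^ (n + 1) := by simp [epsSeq]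
    _ ≤ ε ^ (n + 2) := pow_le_pow_of_le_one hε (by linarith) hn
    _ ≤ (1 / 8) ^ (n + 2) := by gcongr
    _ = 1 / 64 * (1 / 8) ^ n := by ring
    _ ≤ 1 / 64 * (2 / 3) ^ n := by gcongr ?_ * ?_ ^ n; norm_num

theorem alphaSeq_mul_etaP_succ {ε : ℝ} (hε : 0 ≤ ε) (n : ℕ) (η : ℝ) :
    alphaSeq ε (n + 1) * etaP ε (n + 1) η =
      alphaSeq ε (n + 1) * (alphaSeq ε n * etaP ε n η) ^ 2 - epsSeq ε (n + 1) := by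
  have := (alphaSeq_pos hε (n + 1)).ne'
  simp only [etaP]
  field_simp

theorem abs_alphaSeq_mul_etaP_le {ε : ℝ} (hε : 0 ≤ ε) (hε8 : ε ≤ 1 / 8) {η : ℝ}
    (hη : |η| ≤ 1 / 2) (n : ℕ) : |alphaSeq ε n * etaP ε n η| ≤ 1 / 2 * (2 / 3) ^ n := by
  induction n with
  | zero => simpa [alphaSeq, epsSeq, etaP] using hη
  | succ n ih =>
    rw [alphaSeq_mul_etaP_succ hε]
    set x := alphaSeq ε n * etaP ε n η
    have he := epsSeq_succ_le hε hε8 n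
    have he0 := epsSeq_nonneg hε (n + 1)
    have hr0 : (0 : ℝ) < (2 / 3) ^ n := by positivity
    have hr1 : ((2 : ℝ) / 3) ^ n ≤ 1 := pow_le_one₀ (by norm_num) (by norm_num)
    have hx : x ^ 2 ≤ 1 / 4 * (2 / 3) ^ n := by
      rw [← sq_abs]
      nlinarith [abs_nonneg x]
    have hα : alphaSeq ε (n + 1) ≤ 65 / 64 := by
      unfold alphaSeq
      linarith
    have hmul := mul_le_mul hα hx (sq_nonneg x) (by norm_num)
    have hmul0 := mul_nonneg (alphaSeq_pos hε (n + 1)).le (sq_nonneg x)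
    rw [pow_succ (2 / 3 : ℝ), abs_le]
    constructor <;> linarith

/-- For `0 < ε < 1/8` and `|η| ≤ 1/2`: the series `∑ |αₙ ηₙ'(η)|` converges, each factor
`1 + αₙ ηₙ'(η)` is positive, and the infinite product converges to a positive limit. -/
theorem stmt_6 (ε : ℝ) (hε : 0 < ε) (hε8 : ε < 1 / 8) (η : ℝ) (hη : |η| ≤ 1 / 2) :
    Summable (fun n : ℕ => |alphaSeq ε n * etaP ε n η|) ∧
    (∀ n : ℕ, 0 < 1 + alphaSeq ε n * etaP ε n η) ∧
    ∃ L : ℝ, 0 < L ∧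
      Tendsto (fun N : ℕ => ∏ n ∈ Finset.range N, (1 + alphaSeq ε n * etaP ε n η))
        atTop (𝓝 L) := by
  have hbound := abs_alphaSeq_mul_etaP_le hε.le hε8.le hη
  have hsum : Summable fun n : ℕ => |alphaSeq ε n * etaP ε n η| :=
    .of_nonneg_of_le (fun _ => abs_nonneg _) hbound
      ((summable_geometric_of_lt_one (by norm_num) (by norm_num)).mul_left _)
  have hpos : ∀ n : ℕ, 0 < 1 + alphaSeq ε n * etaP ε n η := fun n => by
    have hr : ((2 : ℝ) / 3) ^ n ≤ 1 := pow_le_one₀ (by norm_num) (by norm_num)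
    linarith [(abs_le.mp (hbound n)).1]
  have hlog := (Real.summable_log_one_add_of_summable hsum.of_abs).hasSum
  exact ⟨hsum, hpos, _, Real.exp_pos _, (Real.hasProd_of_hasSum_log hpos hlog).tendsto_prod_nat⟩
end

section
/- For 0 < ε < 1/8, the function g is differentiable at every η with |η| < 1/2, and its derivative is given by the convergent logarithmic-derivative series g'(η) = −g(η) · ∑_{n=0}^∞ [α_n · (d/dη) η_n'(η)] / [1 + α_n η_n'(η)]. -/
open Filter Topology

/-- `C = ∏_{n=1}^∞ (1 + αₙ ηₙ'(0))`. -/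
noncomputable def Cprod (ε : ℝ) : ℝ :=
  ∏' n : ℕ, (1 + alphaSeq ε (n + 1) * etaP ε (n + 1) 0)

/-- `g(η) = C ∏_{n=0}^∞ (1 + αₙ ηₙ'(η))⁻¹`. -/
noncomputable def g (ε : ℝ) (η : ℝ) : ℝ :=
  Cprod ε * ∏' n : ℕ, (1 + alphaSeq ε n * etaP ε n η)⁻¹

/-- `αₙ ηₙ'(x)`, the quantity through which every factor of `g` depends on `x`. -/
noncomputable def scaledEta (ε : ℝ) (n : ℕ) (x : ℝ) : ℝ := alphaSeq ε n * etaP ε n x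

theorem scaledEta_zero (ε x : ℝ) : scaledEta ε 0 x = x := by
  simp [scaledEta, alphaSeq, epsSeq, etaP]

theorem scaledEta_succ {ε : ℝ} (hε : 0 ≤ ε) (n : ℕ) (x : ℝ) :
    scaledEta ε (n + 1) x =
      (1 + epsSeq ε (n + 1)) * scaledEta ε n x ^ 2 - epsSeq ε (n + 1) := by
  have h := (alphaSeq_pos hε (n + 1)).ne'
  simp only [scaledEta, etaP]
  rw [mul_sub, mul_div_cancel₀ _ h]
  simp only [alphaSeq]
  ring

theorem abs_scaledEta_le {ε : ℝ} (hε : 0 ≤ ε) (hε2 : ε ≤ 1 / 2) {x : ℝ} (hx : |x| ≤ 1 / 2)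
    (n : ℕ) : |scaledEta ε n x| ≤ (1 / 2) ^ 2 ^ n := by
  induction n with
  | zero => simpa [scaledEta_zero] using hx
  | succ n ih =>
    have he : epsSeq ε (n + 1) ≤ (1 / 2) ^ 2 ^ (n + 1) := by
      simp only [epsSeq, Nat.add_eq_zero_iff, one_ne_zero, and_false, if_false]
      gcongr
    have h0 := epsSeq_nonneg hε (n + 1)
    have hsq : scaledEta ε n x ^ 2 ≤ (1 / 2) ^ 2 ^ (n + 1) := by
      rw [pow_succ 2 n, pow_mul, ← sq_abs]
      gcongr
    have hle : ((1 : ℝ) / 2) ^ 2 ^ (n + 1) ≤ 1 := pow_le_one₀ (by norm_num) (by norm_num)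
    have hnn := sq_nonneg (scaledEta ε n x)
    rw [scaledEta_succ hε, abs_le]
    constructor <;> nlinarith

theorem half_le_one_add_scaledEta {ε : ℝ} (hε : 0 ≤ ε) (hε2 : ε ≤ 1 / 2) {x : ℝ}
    (hx : |x| ≤ 1 / 2) (n : ℕ) : 1 / 2 ≤ 1 + scaledEta ε n x := by
  have h := (abs_le.mp (abs_scaledEta_le hε hε2 hx n)).1
  have h2 : ((1 : ℝ) / 2) ^ 2 ^ n ≤ 1 / 2 :=
    pow_le_of_le_one (by norm_num) (by norm_num) (by positivity)
  linarith

theorem summable_scaledEta {ε : ℝ} (hε : 0 ≤ ε) (hε2 : ε ≤ 1 / 2) {x : ℝ} (hx : |x| ≤ 1 / 2) :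
    Summable fun n => scaledEta ε n x := by
  refine Summable.of_norm_bounded (summable_geometric_of_lt_one (r := 1 / 2)
    (by norm_num) (by norm_num)) fun n => (abs_scaledEta_le hε hε2 hx n).trans ?_
  exact pow_le_pow_of_le_one (by norm_num) (by norm_num) Nat.lt_two_pow_self.le

theorem differentiable_etaP (ε : ℝ) (n : ℕ) : Differentiable ℝ (etaP ε n) := by
  induction n with
  | zero => exact differentiable_id
  | succ n ih => exact ((ih.pow 2).const_mul _).sub_const _

theorem hasDerivAt_scaledEta (ε : ℝ) (n : ℕ) (x : ℝ) :
    HasDerivAt (scaledEta ε n) (alphaSeq ε n * deriv (etaP ε n) x) x :=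
  ((differentiable_etaP ε n x).hasDerivAt).const_mul _

theorem deriv_scaledEta_succ {ε : ℝ} (hε : 0 ≤ ε) (n : ℕ) (x : ℝ) :
    deriv (scaledEta ε (n + 1)) x =
      (1 + epsSeq ε (n + 1)) * (2 * scaledEta ε n x * deriv (scaledEta ε n) x) := by
  rw [funext (scaledEta_succ hε n)]
  have h := (hasDerivAt_scaledEta ε n x).differentiableAt.hasDerivAt
  simpa using (((h.pow 2).const_mul (1 + epsSeq ε (n + 1))).sub_const (epsSeq ε (n + 1))).deriv

theorem abs_deriv_scaledEta_le {ε : ℝ} (hε : 0 ≤ ε) (hε8 : ε ≤ 1 / 8) {x : ℝ}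
    (hx : |x| ≤ 1 / 2) (n : ℕ) : |deriv (scaledEta ε n) x| ≤ 2 * (5 / 8) ^ n := by
  have hfactor (n : ℕ) : 1 + epsSeq ε (n + 1) ≤ 65 / 64 := by
    have : epsSeq ε (n + 1) ≤ (1 / 8) ^ 2 := by
      simp only [epsSeq, Nat.add_eq_zero_iff, one_ne_zero, and_false, if_false]
      calc ε ^ 2 ^ (n + 1) ≤ ε ^ 2 :=
            pow_le_pow_of_le_one hε (by linarith) (Nat.le_self_pow (by omega) 2)
        _ ≤ (1 / 8) ^ 2 := by gcongr
    linarith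
  have hstep (n : ℕ) : |deriv (scaledEta ε (n + 1)) x| ≤
      65 / 64 * (2 * (1 / 2) ^ 2 ^ n * |deriv (scaledEta ε n) x|) := by
    have h0 := epsSeq_nonneg hε (n + 1)
    rw [deriv_scaledEta_succ hε, abs_mul, abs_mul, abs_mul, abs_two,
      abs_of_nonneg (by linarith : 0 ≤ 1 + epsSeq ε (n + 1))]
    gcongr
    · exact hfactor n
    · exact abs_scaledEta_le hε (by linarith) hx n
  have hzero : deriv (scaledEta ε 0) x = 1 := by
    rw [funext (scaledEta_zero ε)]
    exact deriv_id x
  induction n with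
  | zero => norm_num [hzero]
  | succ n ih =>
    rcases Nat.eq_zero_or_pos n with rfl | hn
    · have := hstep 0
      norm_num [hzero] at this ⊢
      linarith
    · have hpow : ((1 : ℝ) / 2) ^ 2 ^ n ≤ (1 / 2) ^ 2 :=
        pow_le_pow_of_le_one (by norm_num) (by norm_num) (Nat.le_self_pow hn.ne' 2)
      calc _ ≤ _ := hstep n
        _ ≤ 65 / 64 * (2 * (1 / 2) ^ 2 * (2 * (5 / 8) ^ n)) := by gcongr
        _ ≤ 2 * (5 / 8) ^ (n + 1) := by
          have : (0 : ℝ) ≤ (5 / 8) ^ n := by positivity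
          rw [pow_succ _ n]
          linarith

theorem hasDerivAt_log_one_add_scaledEta {ε : ℝ} (hε : 0 ≤ ε) (hε2 : ε ≤ 1 / 2) {x : ℝ}
    (hx : |x| ≤ 1 / 2) (n : ℕ) :
    HasDerivAt (fun y => Real.log (1 + scaledEta ε n y))
      (alphaSeq ε n * deriv (etaP ε n) x / (1 + scaledEta ε n x)) x := by
  have h := half_le_one_add_scaledEta hε hε2 hx n
  exact ((hasDerivAt_scaledEta ε n x).const_add 1).log (by linarith)

theorem norm_logDeriv_term_le {ε : ℝ} (hε : 0 ≤ ε) (hε8 : ε ≤ 1 / 8) {x : ℝ}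
    (hx : |x| ≤ 1 / 2) (n : ℕ) :
    ‖alphaSeq ε n * deriv (etaP ε n) x / (1 + scaledEta ε n x)‖ ≤ 4 * (5 / 8) ^ n := by
  have h := half_le_one_add_scaledEta hε (by linarith) hx n
  have hd := abs_deriv_scaledEta_le hε hε8 hx n
  rw [(hasDerivAt_scaledEta ε n x).deriv] at hd
  rw [norm_div, Real.norm_eq_abs, Real.norm_of_nonneg (by linarith), div_le_iff₀ (by linarith)]
  have : (0 : ℝ) ≤ (5 / 8) ^ n := by positivity
  nlinarith

theorem summable_log_one_add_scaledEta {ε : ℝ} (hε : 0 ≤ ε) (hε2 : ε ≤ 1 / 2) {x : ℝ}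
    (hx : |x| ≤ 1 / 2) : Summable fun n => Real.log (1 + scaledEta ε n x) :=
  Real.summable_log_one_add_of_summable (summable_scaledEta hε hε2 hx)

theorem g_eq_exp_neg_tsum_log {ε : ℝ} (hε : 0 ≤ ε) (hε2 : ε ≤ 1 / 2) {x : ℝ}
    (hx : |x| ≤ 1 / 2) :
    g ε x = Cprod ε * Real.exp (-∑' n, Real.log (1 + scaledEta ε n x)) := by
  have hpos (n : ℕ) : 0 < 1 + scaledEta ε n x := by
    linarith [half_le_one_add_scaledEta hε hε2 hx n]
  have h := Real.rexp_tsum_eq_tprod (f := fun n => (1 + scaledEta ε n x)⁻¹)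
    (fun n => inv_pos.mpr (hpos n))
    (by simpa only [Real.log_inv] using (summable_log_one_add_scaledEta hε hε2 hx).neg)
  simp only [Real.log_inv, tsum_neg] at h
  rw [h]
  rfl

/-- For `0 < ε < 1/8` and `|η| < 1/2`, `g` is differentiable at `η` with derivative given by
the convergent logarithmic-derivative series. -/
theorem stmt_9 (ε : ℝ) (hε : 0 < ε) (hε8 : ε < 1 / 8) (η : ℝ) (hη : |η| < 1 / 2) :
    Summable (fun n : ℕ =>
      alphaSeq ε n * deriv (fun x : ℝ => etaP ε n x) η / (1 + alphaSeq ε n * etaP ε n η)) ∧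
    HasDerivAt (g ε)
      (-(g ε η) * ∑' n : ℕ,
        alphaSeq ε n * deriv (fun x : ℝ => etaP ε n x) η / (1 + alphaSeq ε n * etaP ε n η))
      η := by
  have hsum : Summable fun n : ℕ => (4 : ℝ) * (5 / 8) ^ n :=
    (summable_geometric_of_lt_one (by norm_num) (by norm_num)).mul_left 4
  have hε2 : ε ≤ 1 / 2 := by linarith
  have hball {x : ℝ} (hx : x ∈ Metric.ball (0 : ℝ) (1 / 2)) : |x| ≤ 1 / 2 := by
    simpa using (mem_ball_zero_iff.mp hx).le
  have hηball : η ∈ Metric.ball (0 : ℝ) (1 / 2) := by simpa using hη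
  refine ⟨Summable.of_norm_bounded hsum (norm_logDeriv_term_le hε.le hε8.le hη.le), ?_⟩
  have hlog := hasDerivAt_tsum_of_isPreconnected hsum Metric.isOpen_ball
    (convex_ball (0 : ℝ) (1 / 2)).isPreconnected
    (fun n x hx => hasDerivAt_log_one_add_scaledEta hε.le hε2 (hball hx) n)
    (fun n x hx => norm_logDeriv_term_le hε.le hε8.le (hball hx) n)
    hηball (summable_log_one_add_scaledEta hε.le hε2 hη.le) hηball
  have hg : g ε =ᶠ[𝓝 η] fun x => Cprod ε * Real.exp (-∑' n, Real.log (1 + scaledEta ε n x)) := by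
    filter_upwards [Metric.isOpen_ball.mem_nhds hηball] with x hx
    exact g_eq_exp_neg_tsum_log hε.le hε2 (hball hx)
  refine ((hlog.neg.exp.const_mul (Cprod ε)).congr_of_eventuallyEq hg).congr_deriv ?_
  rw [g_eq_exp_neg_tsum_log hε.le hε2 hη.le]
  simp only [scaledEta, Pi.neg_apply]
  ring
end
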